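/- Fix 𝔘 ∈ ℝ, let M_𝔘(v) = (2π)^{−3/2} exp(−((v_x−𝔘)² + v_y² + v_z²)/2) for v = (v_x, v_y, v_z) ∈ ℝ³, and for differentiable f : ℝ³ → ℝ define (N f)(v) = v_x² ∂f/∂v_y − v_x v_y ∂f/∂v_x − 𝔘 v_x v_y f(v). Then for every Schwartz function f : ℝ³ → ℝ, ∫_{ℝ³} M_𝔘(v) (N f)(v) dv = ∫_{ℝ³} M_𝔘(v) v_y f(v) dv. -/

import Mathlib

open MeasureTheory Real

/-- The Maxwellian on `ℝ³` drifted by `𝔘` in the `x`-direction. -/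
noncomputable def Mdrift (𝔘 : ℝ) (v : Fin 3 → ℝ) : ℝ :=
  (2 * π) ^ (-(3 : ℝ) / 2) * exp (-(((v 0 - 𝔘) ^ 2 + (v 1) ^ 2 + (v 2) ^ 2) / 2))

/-- The (conjugated) force operator from the cylindrical geometry:
`(N f)(v) = vₓ² ∂f/∂v_y − vₓ v_y ∂f/∂vₓ − 𝔘 vₓ v_y f(v)`. -/
noncomputable def Nforce (𝔘 : ℝ) (f : (Fin 3 → ℝ) → ℝ) (v : Fin 3 → ℝ) : ℝ :=
  (v 0) ^ 2 * fderiv ℝ f v (Pi.single 1 1) - v 0 * v 1 * fderiv ℝ f v (Pi.single 0 1)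
    - 𝔘 * v 0 * v 1 * f v

theorem hasFDerivAt_Mdrift (𝔘 : ℝ) (v : Fin 3 → ℝ) :
    HasFDerivAt (Mdrift 𝔘) (-Mdrift 𝔘 v • ((v 0 - 𝔘) • ContinuousLinearMap.proj (R := ℝ) 0 +
      v 1 • ContinuousLinearMap.proj 1 + v 2 • ContinuousLinearMap.proj 2 :
        (Fin 3 → ℝ) →L[ℝ] ℝ)) v := by
  have h (i : Fin 3) : HasFDerivAt (fun w : Fin 3 → ℝ ↦ w i)
      (ContinuousLinearMap.proj i : (Fin 3 → ℝ) →L[ℝ] ℝ) v := hasFDerivAt_apply i v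
  have hq := (((((h 0).sub_const 𝔘).pow 2).add ((h 1).pow 2)).add ((h 2).pow 2)).mul_const
    (2⁻¹ : ℝ)
  refine (hq.neg.exp.const_mul ((2 * π) ^ (-(3 : ℝ) / 2))).congr_fderiv ?_
  ext w
  simp [Mdrift, div_eq_mul_inv]
  ring

theorem continuous_Mdrift (𝔘 : ℝ) : Continuous (Mdrift 𝔘) :=
  continuous_iff_continuousAt.2 fun v ↦ (hasFDerivAt_Mdrift 𝔘 v).continuousAt

theorem integrable_Mdrift_mul (𝔘 : ℝ) {g : (Fin 3 → ℝ) → ℝ} (hg : Integrable g) :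
    Integrable fun v ↦ Mdrift 𝔘 v * g v := by
  refine hg.bdd_mul (c := (2 * π) ^ (-(3 : ℝ) / 2)) (continuous_Mdrift 𝔘).aestronglyMeasurable
    (.of_forall fun v ↦ ?_)
  rw [Mdrift, norm_mul, norm_of_nonneg (by positivity), norm_of_nonneg (by positivity)]
  refine mul_le_of_le_one_right (by positivity) (exp_le_one_iff.2 ?_)
  rw [neg_nonpos]
  positivity

open scoped LineDeriv in
theorem integrable_Mdrift_mul_fderiv (𝔘 : ℝ) (φ : SchwartzMap (Fin 3 → ℝ) ℝ) (e : Fin 3 → ℝ) :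
    Integrable fun v ↦ Mdrift 𝔘 v * fderiv ℝ φ v e :=
  integrable_Mdrift_mul 𝔘 (∂_{e} φ).integrable

theorem hasTemperateGrowth_coord (i : Fin 3) :
    (fun v : Fin 3 → ℝ ↦ v i).HasTemperateGrowth :=
  (ContinuousLinearMap.proj i : (Fin 3 → ℝ) →L[ℝ] ℝ).hasTemperateGrowth

theorem integrable_Mdrift_mul_temperate (𝔘 : ℝ) {p : (Fin 3 → ℝ) → ℝ}
    (hp : p.HasTemperateGrowth) (φ : SchwartzMap (Fin 3 → ℝ) ℝ) :
    Integrable fun v ↦ Mdrift 𝔘 v * (p v * φ v) := by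
  have h := (SchwartzMap.smulLeftCLM ℝ p φ).integrable (μ := volume)
  simpa [SchwartzMap.smulLeftCLM_apply hp] using integrable_Mdrift_mul 𝔘 h

/-- Gaussian integration by parts against the drifted Maxwellian. -/
theorem integral_Mdrift_mul_fderiv (𝔘 : ℝ) (φ : SchwartzMap (Fin 3 → ℝ) ℝ) {e : Fin 3 → ℝ}
    {p : (Fin 3 → ℝ) → ℝ} (hp : p.HasTemperateGrowth)
    (he : ∀ v, (v 0 - 𝔘) * e 0 + v 1 * e 1 + v 2 * e 2 = p v) :
    ∫ v, Mdrift 𝔘 v * fderiv ℝ φ v e = ∫ v, Mdrift 𝔘 v * (p v * φ v) := by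
  have hM (v : Fin 3 → ℝ) : fderiv ℝ (Mdrift 𝔘) v e = -(Mdrift 𝔘 v * p v) := by
    rw [(hasFDerivAt_Mdrift 𝔘 v).fderiv, ← he]
    simp
    ring
  rw [integral_mul_fderiv_eq_neg_fderiv_mul_of_integrable, ← integral_neg]
  · simp only [hM, neg_mul, neg_neg, mul_assoc]
  · simpa only [hM, neg_mul, mul_assoc] using (integrable_Mdrift_mul_temperate 𝔘 hp φ).fun_neg
  · exact integrable_Mdrift_mul_fderiv 𝔘 φ e
  · exact integrable_Mdrift_mul 𝔘 φ.integrable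
  · exact fun v _ ↦ (hasFDerivAt_Mdrift 𝔘 v).differentiableAt
  · exact fun v _ ↦ φ.differentiableAt

/-- The identity `(1, N g) = (v_y, g)` used in Section 3 of the paper. -/
theorem force_mass_moment_identity (𝔘 : ℝ) (f : SchwartzMap (Fin 3 → ℝ) ℝ) :
    ∫ v : Fin 3 → ℝ, Mdrift 𝔘 v * Nforce 𝔘 (⇑f) v =
      ∫ v : Fin 3 → ℝ, Mdrift 𝔘 v * v 1 * f v := by
  have hx := hasTemperateGrowth_coord 0
  have hy := hasTemperateGrowth_coord 1
  obtain ⟨φ, hφv⟩ : ∃ φ : SchwartzMap (Fin 3 → ℝ) ℝ, ∀ v, φ v = v 0 * v 0 * f v :=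
    ⟨_, SchwartzMap.smulLeftCLM_apply_apply (hx.mul hx) f⟩
  obtain ⟨ψ, hψv⟩ : ∃ ψ : SchwartzMap (Fin 3 → ℝ) ℝ, ∀ v, ψ v = v 0 * v 1 * f v :=
    ⟨_, SchwartzMap.smulLeftCLM_apply_apply (hx.mul hy) f⟩
  have hd (i : Fin 3) (v) : HasFDerivAt (fun w : Fin 3 → ℝ ↦ w i)
      (ContinuousLinearMap.proj i : (Fin 3 → ℝ) →L[ℝ] ℝ) v := hasFDerivAt_apply i v
  have hf (v) := (f.differentiableAt (x := v)).hasFDerivAt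
  have hφd (v) : fderiv ℝ φ v (Pi.single 1 1) = v 0 ^ 2 * fderiv ℝ f v (Pi.single 1 1) := by
    rw [funext hφv, (((hd 0 v).fun_mul (hd 0 v)).fun_mul (hf v)).fderiv]
    simp [sq]
  have hψd (v) : fderiv ℝ ψ v (Pi.single 0 1) =
      v 0 * v 1 * fderiv ℝ f v (Pi.single 0 1) + v 1 * f v := by
    rw [funext hψv, (((hd 0 v).fun_mul (hd 1 v)).fun_mul (hf v)).fderiv]
    simp
    ring
  have hxU := hx.fun_sub (.const 𝔘)
  have hIφ := integral_Mdrift_mul_fderiv 𝔘 φ (e := Pi.single 1 1) hy (by simp)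
  have hIψ := integral_Mdrift_mul_fderiv 𝔘 ψ (e := Pi.single 0 1) hxU (by simp)
  have iφ := integrable_Mdrift_mul_fderiv 𝔘 φ (Pi.single 1 1)
  have iψ := integrable_Mdrift_mul_fderiv 𝔘 ψ (Pi.single 0 1)
  have jφ := integrable_Mdrift_mul_temperate 𝔘 hy φ
  have jψ := integrable_Mdrift_mul_temperate 𝔘 hxU ψ
  have hR : Integrable fun v ↦ Mdrift 𝔘 v * v 1 * f v := by
    simpa only [mul_assoc] using integrable_Mdrift_mul_temperate 𝔘 hy f
  have hsplit (v) : Mdrift 𝔘 v * Nforce 𝔘 f v =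
      (Mdrift 𝔘 v * fderiv ℝ φ v (Pi.single 1 1) - Mdrift 𝔘 v * (v 1 * φ v)) -
      (Mdrift 𝔘 v * fderiv ℝ ψ v (Pi.single 0 1) - Mdrift 𝔘 v * ((v 0 - 𝔘) * ψ v)) +
      Mdrift 𝔘 v * v 1 * f v := by
    rw [hφd, hψd, hφv, hψv, Nforce]
    ring
  have kφ : Integrable fun v ↦
      Mdrift 𝔘 v * fderiv ℝ φ v (Pi.single 1 1) - Mdrift 𝔘 v * (v 1 * φ v) := iφ.sub jφ
  have kψ : Integrable fun v ↦
      Mdrift 𝔘 v * fderiv ℝ ψ v (Pi.single 0 1) - Mdrift 𝔘 v * ((v 0 - 𝔘) * ψ v) := iψ.sub jψ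
  simp_rw [hsplit]
  rw [integral_add (by exact kφ.sub kψ) hR, integral_sub kφ kψ, integral_sub iφ jφ,
    integral_sub iψ jψ, hIφ, hIψ]
  simp
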